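/- arXiv:1506.07290 — 8 statements merged into one kernel-verified Lean document; each statement's English description precedes it below -/
import Mathlib

section
/- (Recursivity) Let T be a monad on a category C and let (X, e) be a T-coalgebra that is recursive, i.e. for every algebra (Z, g : T Z ⟶ Z) of the endofunctor T there exists a unique coalgebra–algebra homomorphism from (X, e) to (Z, g). Then for every object Y of C there exists a unique Kleisli-coinductive solution h : X ⟶ T Y of e, and moreover for every Eilenberg–Moore algebra structure f : T Y ⟶ Y of T on Y, the composite h ≫ f is the unique coalgebra–algebra homomorphism from (X, e) to (Y, f). -/
open CategoryTheory

/-- (Recursivity)  If the `T`-coalgebra `(X, e)` is recursive — i.e. admits a unique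
coalgebra–algebra homomorphism into every algebra of the endofunctor `T` — then for
every object `Y` there is a unique Kleisli-coinductive solution `h : X ⟶ T Y` of `e`,
and for every Eilenberg–Moore algebra structure `f : T Y ⟶ Y` of `T` on `Y`, the
composite `h ≫ f` is the unique coalgebra–algebra homomorphism from `(X, e)` to
`(Y, f)`. -/
theorem kleisli_coinductive_recursivity
    {C : Type*} [Category C] (T : Monad C) {X : C}
    (e : X ⟶ T.obj X)
    (hrec : ∀ (Z : C) (g : T.obj Z ⟶ Z), ∃! k : X ⟶ Z, k = e ≫ T.map k ≫ g)
    (Y : C) :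
    (∃! h : X ⟶ T.obj Y, h = e ≫ T.map h ≫ T.μ.app Y) ∧
    (∀ h : X ⟶ T.obj Y, h = e ≫ T.map h ≫ T.μ.app Y →
      ∀ f : T.obj Y ⟶ Y,
        T.η.app Y ≫ f = 𝟙 Y → T.μ.app Y ≫ f = T.map f ≫ f →
          ∀ k : X ⟶ Y, (k = e ≫ T.map k ≫ f ↔ k = h ≫ f)) := by
  refine ⟨hrec _ (T.μ.app Y), fun h hh f _ hμ k ↦ ?_⟩
  have hom : h ≫ f = e ≫ T.map (h ≫ f) ≫ f :=
    calc h ≫ f = (e ≫ T.map h ≫ T.μ.app Y) ≫ f := congrArg (· ≫ f) hh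
      _ = e ≫ T.map (h ≫ f) ≫ f := by
        simp only [Category.assoc, Functor.map_comp, hμ]
  exact ⟨fun hk ↦ (hrec Y f).unique hk hom, fun hk ↦ hk ▸ hom⟩
end

section
/- (Universality of co-Kleisli induction) Let D be a comonad on a category C, let (Y, k : D Y ⟶ Y) be an algebra of the endofunctor D, and let h : D X ⟶ Y be a co-Kleisli-inductive solution of k. Then for every Eilenberg–Moore coalgebra structure f : X ⟶ D X of the comonad D on X, the composite f ≫ h : X ⟶ Y is a coalgebra–algebra homomorphism from (X, f) to (Y, k); that is, f ≫ D.map (f ≫ h) ≫ k = f ≫ h. -/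
open CategoryTheory

/-- (Universality of co-Kleisli induction)  If `h : D X ⟶ Y` is a
co-Kleisli-inductive solution of the `D`-algebra `k : D Y ⟶ Y`, then for every
Eilenberg–Moore coalgebra structure `f : X ⟶ D X` of the comonad `D` on `X`, the
composite `f ≫ h` is a coalgebra–algebra homomorphism from `(X, f)` to `(Y, k)`. -/
theorem cokleisli_inductive_universality
    {C : Type*} [Category C] (D : Comonad C) {X Y : C}
    (k : D.obj Y ⟶ Y) (h : D.obj X ⟶ Y)
    (hsol : h = D.δ.app X ≫ D.map h ≫ k)
    (f : X ⟶ D.obj X)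
    (hcounit : f ≫ D.ε.app X = 𝟙 X)
    (hcomul : f ≫ D.δ.app X = f ≫ D.map f) :
    f ≫ D.map (f ≫ h) ≫ k = f ≫ h := by
  calc f ≫ D.map (f ≫ h) ≫ k = (f ≫ D.map f) ≫ D.map h ≫ k := by
        simp only [Functor.map_comp, Category.assoc]
    _ = f ≫ D.δ.app X ≫ D.map h ≫ k := by rw [← hcomul, Category.assoc]
    _ = f ≫ h := by rw [← hsol]
end

section
/- (Corecursivity) Let D be a comonad on a category C and let (Y, k : D Y ⟶ Y) be an algebra of the endofunctor D that is corecursive, i.e. for every coalgebra (X, f : X ⟶ D X) of the endofunctor D there exists a unique coalgebra–algebra homomorphism from (X, f) to (Y, k). Then for every object X of C there exists a unique co-Kleisli-inductive solution h : D X ⟶ Y of k, and moreover for every Eilenberg–Moore coalgebra structure f : X ⟶ D X of D on X, the composite f ≫ h is the unique coalgebra–algebra homomorphism from (X, f) to (Y, k). -/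
open CategoryTheory

/-- (Corecursivity)  If the `D`-algebra `(Y, k)` is corecursive — i.e. admits a
unique coalgebra–algebra homomorphism from every coalgebra of the endofunctor `D` —
then for every object `X` there is a unique co-Kleisli-inductive solution
`h : D X ⟶ Y` of `k`, and for every Eilenberg–Moore coalgebra structure
`f : X ⟶ D X` of `D` on `X`, the composite `f ≫ h` is the unique coalgebra–algebra
homomorphism from `(X, f)` to `(Y, k)`. -/
theorem cokleisli_inductive_corecursivity
    {C : Type*} [Category C] (D : Comonad C) {Y : C}
    (k : D.obj Y ⟶ Y)
    (hcorec : ∀ (X : C) (f : X ⟶ D.obj X), ∃! m : X ⟶ Y, m = f ≫ D.map m ≫ k)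
    (X : C) :
    (∃! h : D.obj X ⟶ Y, h = D.δ.app X ≫ D.map h ≫ k) ∧
    (∀ h : D.obj X ⟶ Y, h = D.δ.app X ≫ D.map h ≫ k →
      ∀ f : X ⟶ D.obj X,
        f ≫ D.ε.app X = 𝟙 X → f ≫ D.δ.app X = f ≫ D.map f →
          ∀ m : X ⟶ Y, (m = f ≫ D.map m ≫ k ↔ m = f ≫ h)) := by
  refine ⟨hcorec (D.obj X) (D.δ.app X), fun h hh f _ hf m => ?_⟩
  have hfh : f ≫ h = f ≫ D.map (f ≫ h) ≫ k := by
    calc f ≫ h = (f ≫ D.δ.app X) ≫ D.map h ≫ k := by rw [Category.assoc, ← hh]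
      _ = f ≫ D.map (f ≫ h) ≫ k := by
        rw [hf, Functor.map_comp, Category.assoc, Category.assoc]
  exact ⟨fun hm => (hcorec X f).unique hm hfh, fun hm => hm ▸ hfh⟩
end

section
/- Let (M, +, 0) be an additive monoid, X a type, and e : X → M × X. If the relation ⤳_e is consistent, then the time-stamps it assigns are unique: for all x, x' ∈ X and t, u ∈ M, if x ⤳_e (t, x') and x ⤳_e (u, x'), then t = u. -/
/-- Kleisli extension of `e : X → M × X` for the writer monad `T X = M × X`:
`klex e (t, x) = (t + u, x')` where `e x = (u, x')`. -/
def klex {M X : Type*} [AddMonoid M] (e : X → M × X) : M × X → M × X :=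
  fun p => (p.1 + (e p.2).1, (e p.2).2)

/-- `x ⤳_e (t, x')` iff some iterate of the Kleisli extension sends `(0, x)` to
`(t, x')`. -/
def Leadsto {M X : Type*} [AddMonoid M] (e : X → M × X) (x : X) (p : M × X) : Prop :=
  ∃ n : ℕ, (klex e)^[n] (0, x) = p

/-- `⤳_e` is consistent iff `x ⤳_e (t, x)` implies `t = 0`. -/
def Consistent {M X : Type*} [AddMonoid M] (e : X → M × X) : Prop :=
  ∀ (x : X) (t : M), Leadsto e x (t, x) → t = 0

/-- Iterating `klex e` from time-stamp `t` is iterating from `0` and then shifting by `t`. -/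
theorem klex_iterate {M X : Type*} [AddMonoid M] (e : X → M × X) (n : ℕ) (t : M) (x : X) :
    (klex e)^[n] (t, x) = (t + ((klex e)^[n] (0, x)).1, ((klex e)^[n] (0, x)).2) := by
  induction n with
  | zero => simp
  | succ n ih =>
    rw [Function.iterate_succ_apply', Function.iterate_succ_apply', ih]
    simp [klex, add_assoc]

/-- Two visits to the same state carry the same time-stamp when `⤳_e` is consistent. -/
theorem Consistent.timestamp_eq_of_le {M X : Type*} [AddMonoid M] {e : X → M × X}
    (hcons : Consistent e) {x x' : X} {t u : M} {m n : ℕ} (hmn : m ≤ n)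
    (hm : (klex e)^[m] (0, x) = (t, x')) (hn : (klex e)^[n] (0, x) = (u, x')) : t = u := by
  obtain ⟨k, rfl⟩ := Nat.exists_eq_add_of_le' hmn
  rw [Function.iterate_add_apply, hm, klex_iterate, Prod.mk.injEq] at hn
  have hzero : ((klex e)^[k] (0, x')).1 = 0 := hcons x' _ ⟨k, Prod.ext rfl hn.2⟩
  rw [← hn.1, hzero, add_zero]

/-- If `⤳_e` is consistent, its time-stamps are unique. -/
theorem leadsto_timestamp_unique
    {M X : Type*} [AddMonoid M] (e : X → M × X)
    (hcons : Consistent e)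
    (x x' : X) (t u : M)
    (ht : Leadsto e x (t, x')) (hu : Leadsto e x (u, x')) :
    t = u := by
  obtain ⟨m, hm⟩ := ht
  obtain ⟨n, hn⟩ := hu
  rcases le_total m n with hmn | hnm
  · exact hcons.timestamp_eq_of_le hmn hm hn
  · exact (hcons.timestamp_eq_of_le hnm hn hm).symm
end

section
/- Let (M, +, 0) be an additive monoid with right cancellation, i.e. for all t, u ∈ M, t + u = u implies t = 0. Let X and Y be types and e : X → M × X. If there exists a Kleisli-coinductive solution h : X → M × Y of e, then ⤳_e is consistent: x ⤳_e (t, x) implies t = 0. -/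
/-- A Kleisli-coinductive solution of `e : X → M × X`: whenever `e x = (t, x')`
and `h x' = (u, y)`, one has `h x = (t + u, y)`. -/
def IsKleisliSolution {M X Y : Type*} [AddMonoid M]
    (e : X → M × X) (h : X → M × Y) : Prop :=
  ∀ x : X, h x = ((e x).1 + (h (e x).2).1, (h (e x).2).2)

/-- Along `klex e`, the accumulated output plus the output of a solution is invariant. -/
theorem IsKleisliSolution.iterate_klex_fst_add {M X Y : Type*} [AddMonoid M]
    {e : X → M × X} {h : X → M × Y} (hsol : IsKleisliSolution e h) (n : ℕ) (p : M × X) :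
    ((klex e)^[n] p).1 + (h ((klex e)^[n] p).2).1 = p.1 + (h p.2).1 := by
  induction n generalizing p with
  | zero => rfl
  | succ n ih =>
    rw [Function.iterate_succ_apply, ih, hsol p.2]
    simp only [klex, add_assoc]

/-- If `M` has right cancellation and `e` admits a Kleisli-coinductive solution,
then `⤳_e` is consistent. -/
theorem solvable_implies_consistent
    {M X Y : Type*} [AddMonoid M]
    (hcancel : ∀ t u : M, t + u = u → t = 0)
    (e : X → M × X)
    (h : X → M × Y) (hsol : IsKleisliSolution e h) :
    Consistent e := by
  rintro x t ⟨n, hn⟩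
  have key := hsol.iterate_klex_fst_add n (0, x)
  rw [hn, zero_add] at key
  exact hcancel t _ key
end

section
/- Let (M, +, 0) be an additive monoid with right cancellation (t + u = u implies t = 0), let X be a type, e : X → M × X, and let Y be a nonempty type. If ⤳_e is consistent and the strict order ≻_e is well-founded, then there exists a Kleisli-coinductive solution h : X → M × Y of e. -/
/-- The preorder `⪰_e`: reflexive-transitive closure of the step relation
`x ▷_e x' ↔ (e x).2 = x'`. -/
def Reaches {M X : Type*} [AddMonoid M] (e : X → M × X) : X → X → Prop :=
  Relation.ReflTransGen (fun a b => (e a).2 = b)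

/-- The strict part `≻_e` of `⪰_e`, read here as "`x'` is strictly below `x`". -/
def StrictBelow {M X : Type*} [AddMonoid M] (e : X → M × X) (x' x : X) : Prop :=
  Reaches e x x' ∧ ¬ Reaches e x' x

/-- Iterating the Kleisli extension commutes with adding a weight on the left. -/
lemma klex_iterate_add_left {M X : Type*} [AddMonoid M] (e : X → M × X) (n : ℕ) (s t : M)
    (x : X) :
    (klex e)^[n] (s + t, x) = (s + ((klex e)^[n] (t, x)).1, ((klex e)^[n] (t, x)).2) := by
  induction n generalizing t x with
  | zero => rfl
  | succ n ih =>
    simp only [Function.iterate_succ_apply, klex, add_assoc]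
    exact ih _ _

lemma klex_iterate_eq {M X : Type*} [AddMonoid M] (e : X → M × X) (n : ℕ) (s : M) (x : X) :
    (klex e)^[n] (s, x) = (s + ((klex e)^[n] (0, x)).1, ((klex e)^[n] (0, x)).2) := by
  simpa using klex_iterate_add_left e n s 0 x

lemma Leadsto.head {M X : Type*} [AddMonoid M] {e : X → M × X} {x p : X} {t : M}
    (h : Leadsto e (e x).2 (t, p)) : Leadsto e x ((e x).1 + t, p) := by
  obtain ⟨n, hn⟩ := h
  refine ⟨n + 1, ?_⟩
  rw [Function.iterate_succ_apply]
  simp only [klex, zero_add]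
  rw [klex_iterate_eq, hn]

lemma Reaches.exists_leadsto {M X : Type*} [AddMonoid M] {e : X → M × X} {x p : X}
    (h : Reaches e x p) : ∃ t, Leadsto e x (t, p) := by
  induction h using Relation.ReflTransGen.head_induction_on with
  | refl => exact ⟨0, 0, rfl⟩
  | head hstep _ ih =>
    subst hstep
    obtain ⟨t, ht⟩ := ih
    exact ⟨_, ht.head⟩

/-- If `⤳_e` is consistent, the weight accumulated between two points is unique. -/
lemma Consistent.leadsto_unique {M X : Type*} [AddMonoid M] {e : X → M × X}
    (hcons : Consistent e) {x p : X} {t u : M}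
    (ht : Leadsto e x (t, p)) (hu : Leadsto e x (u, p)) : t = u := by
  obtain ⟨m, hm⟩ := ht
  obtain ⟨n, hn⟩ := hu
  wlog hmn : m ≤ n generalizing m n t u
  · exact (this n hn m hm (le_of_not_ge hmn)).symm
  obtain ⟨k, rfl⟩ := Nat.exists_eq_add_of_le' hmn
  rw [Function.iterate_add_apply, hm, klex_iterate_eq, Prod.mk.injEq] at hn
  obtain ⟨hweight, hpoint⟩ := hn
  have hcycle : ((klex e)^[k] (0, p)).1 = 0 := hcons p _ ⟨k, Prod.ext rfl hpoint⟩
  rwa [hcycle, add_zero] at hweight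

/-- The points reachable from `x` that lie on a cycle of `e`. -/
def reachableCycle {M X : Type*} [AddMonoid M] (e : X → M × X) (x : X) : Set X :=
  {p | Reaches e x p ∧ Reaches e (e p).2 p}

lemma reachableCycle_step {M X : Type*} [AddMonoid M] (e : X → M × X) (x : X) :
    reachableCycle e (e x).2 = reachableCycle e x := by
  ext p
  refine and_congr_left fun hp => ⟨fun h => Relation.ReflTransGen.head rfl h, fun h => ?_⟩
  rcases Relation.ReflTransGen.cases_head h with rfl | ⟨y, rfl, hy⟩
  · exact hp
  · exact hy

lemma reachableCycle_nonempty {M X : Type*} [AddMonoid M] {e : X → M × X}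
    (hwf : WellFounded (StrictBelow e)) (x : X) : (reachableCycle e x).Nonempty := by
  induction x using hwf.induction with
  | _ x ih =>
    by_cases hx : Reaches e (e x).2 x
    · exact ⟨x, Relation.ReflTransGen.refl, hx⟩
    · rw [← reachableCycle_step]
      exact ih _ ⟨Relation.ReflTransGen.single rfl, hx⟩

/-- If `M` has right cancellation, `⤳_e` is consistent and `≻_e` is well-founded,
then `e` has a Kleisli-coinductive solution (with values in any nonempty `Y`). -/
theorem consistent_wellfounded_implies_solvable
    {M X Y : Type*} [AddMonoid M] [Nonempty Y]
    (hcancel : ∀ t u : M, t + u = u → t = 0)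
    (e : X → M × X)
    (hcons : Consistent e)
    (hwf : WellFounded (StrictBelow e)) :
    ∃ h : X → M × Y, IsKleisliSolution e h := by
  obtain ⟨y⟩ := ‹Nonempty Y›
  have hne := reachableCycle_nonempty hwf
  let c : X → X := fun x => (hne x).some
  have hc (x : X) : c (e x).2 = c x := by
    simp only [c, reachableCycle_step]
  choose w hw using fun x => (hne x).some_mem.1.exists_leadsto
  refine ⟨fun x => (w x, y), fun x => Prod.ext ?_ rfl⟩
  have hstep : Leadsto e (e x).2 (w (e x).2, c x) := hc x ▸ hw (e x).2
  exact hcons.leadsto_unique (hw x) hstep.head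
end

section
/- Let V be a real normed vector space with a fixed nonzero vector e ∈ V, let G be the group of linear isometric equivalences of V, and let C := ℝ → V. Then for every list t over G ⊕ C of length ℓ, the endpoint of step is predicted by span: step t ℓ = span t (where ℓ is taken as a real number). -/
/-- The overall displacement (`span`) effected by tracing a list of turns
(linear isometric equivalences of `V`) and curves `ℝ → V`, relative to the fixed
unit vector `e`. -/
def spanL {V : Type*} [NormedAddCommGroup V] [NormedSpace ℝ V] (e : V) :
    List ((V ≃ₗᵢ[ℝ] V) ⊕ (ℝ → V)) → V
  | [] => 0
  | (Sum.inl ρ) :: u => ρ (spanL e u)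
  | (Sum.inr _) :: u => e + spanL e u

/-- The overall change of orientation (`dir`) effected by a list of turns and
curves. -/
def dirL {V : Type*} [NormedAddCommGroup V] [NormedSpace ℝ V] :
    List ((V ≃ₗᵢ[ℝ] V) ⊕ (ℝ → V)) → (V ≃ₗᵢ[ℝ] V)
  | [] => 1
  | (Sum.inl ρ) :: u => ρ * dirL u
  | (Sum.inr _) :: u => dirL u

/-- Concrete interpretation of a rule body: subcurves are spliced sequentially,
turns become constant unit-length segments, as in `turtle' graphics. -/
noncomputable def stepL {V : Type*} [NormedAddCommGroup V] [NormedSpace ℝ V] (e : V) :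
    List ((V ≃ₗᵢ[ℝ] V) ⊕ (ℝ → V)) → ℝ → V
  | [], _ => 0
  | (Sum.inl ρ) :: u, z => if 1 < z then ρ (stepL e u (z - 1)) else 0
  | (Sum.inr f) :: u, z =>
      if 1 < z then e + stepL e u (z - 1)
      else if z = 1 then e
      else if 0 < z then f z
      else 0

/-- The endpoint of `step` is predicted by `span`:
`step t ℓ = span t` where `ℓ` is the length of `t`. -/
theorem stepL_length_eq_spanL
    {V : Type*} [NormedAddCommGroup V] [NormedSpace ℝ V]
    (e : V) (he : e ≠ 0)
    (t : List ((V ≃ₗᵢ[ℝ] V) ⊕ (ℝ → V))) :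
    stepL e t (t.length : ℝ) = spanL e t := by
  induction t with
  | nil => simp [stepL, spanL]
  | cons a u ih =>
    rcases eq_or_ne u [] with rfl | hne
    · cases a <;> simp [stepL, spanL]
    · have hu : (1 : ℝ) < ((a :: u).length : ℝ) := by
        exact_mod_cast (by simpa [List.length_pos_iff] using hne : 1 < (a :: u).length)
      have hsub : ((a :: u).length : ℝ) - 1 = u.length := by simp
      cases a <;> rw [stepL, if_pos hu, hsub, ih, spanL]
end

section
/- Let V be a real normed vector space with a fixed nonzero vector e ∈ V, let G be the group of linear isometric equivalences of V, and let C := ℝ → V. Call f ∈ C a unit curve iff f is continuous on the closed interval [0, 1], f 0 = 0, and f 1 = e. Let (a, t) be a rule with t : List (G ⊕ C) nonempty of length ℓ, and define draw (a, t) : ℝ → V by draw (a, t) z = a⁻¹ • step t (ℓ · z). If (a, t) is well-formed (a > 1, span t = a • e, dir t = 1) and every entry of t of the form inr f is a unit curve, then draw (a, t) is a unit curve: it is continuous on [0, 1], draw (a, t) 0 = 0, and draw (a, t) 1 = e. -/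
/-- `f : ℝ → V` is a unit curve iff it is continuous on `[0, 1]`, starts at `0`
and ends at the unit vector `e`. -/
def IsUnitCurve {V : Type*} [NormedAddCommGroup V] [NormedSpace ℝ V]
    (e : V) (f : ℝ → V) : Prop :=
  ContinuousOn f (Set.Icc (0 : ℝ) 1) ∧ f 0 = 0 ∧ f 1 = e

/-- A rule `(a, t)` is well-formed iff `a > 1`, `span t = a • e` and `dir t = 1`. -/
def WellFormedRule {V : Type*} [NormedAddCommGroup V] [NormedSpace ℝ V]
    (e : V) (r : ℝ × List ((V ≃ₗᵢ[ℝ] V) ⊕ (ℝ → V))) : Prop :=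
  1 < r.1 ∧ spanL e r.2 = r.1 • e ∧ dirL r.2 = 1

/-- The interpretation of a rule `(a, t)`: trace the subcurves and turns of `t`
sequentially, then compress the domain by the length of `t` and the result by the
shrink factor `a`. -/
noncomputable def draw {V : Type*} [NormedAddCommGroup V] [NormedSpace ℝ V]
    (e : V) (r : ℝ × List ((V ≃ₗᵢ[ℝ] V) ⊕ (ℝ → V))) : ℝ → V :=
  fun z => r.1⁻¹ • stepL e r.2 ((r.2.length : ℝ) * z)

section Step

variable {V : Type*} [NormedAddCommGroup V] [NormedSpace ℝ V] {e : V}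

theorem stepL_of_nonpos (t : List ((V ≃ₗᵢ[ℝ] V) ⊕ (ℝ → V))) {z : ℝ} (hz : z ≤ 0) :
    stepL e t z = 0 := by
  rcases t with _ | ⟨ρ | f, u⟩
  · rfl
  · rw [stepL, if_neg (by linarith)]
  · rw [stepL, if_neg (by linarith), if_neg (by linarith), if_neg (by linarith)]

theorem stepL_inl_cons (ρ : V ≃ₗᵢ[ℝ] V) (u : List ((V ≃ₗᵢ[ℝ] V) ⊕ (ℝ → V))) (z : ℝ) :
    stepL e (Sum.inl ρ :: u) z = ρ (stepL e u (z - 1)) := by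
  rw [stepL]
  split_ifs with h
  · rfl
  · rw [stepL_of_nonpos u (by linarith), map_zero]

theorem stepL_inr_cons {f : ℝ → V} (hf : IsUnitCurve e f)
    (u : List ((V ≃ₗᵢ[ℝ] V) ⊕ (ℝ → V))) (z : ℝ) :
    stepL e (Sum.inr f :: u) z =
      Set.IccExtend zero_le_one ((Set.Icc (0 : ℝ) 1).domRestrict f) z + stepL e u (z - 1) := by
  obtain ⟨-, hf0, hf1⟩ := hf
  rw [stepL]
  split_ifs with h1 h2 h3
  · rw [Set.IccExtend_of_right_le _ _ h1.le, Set.domRestrict_apply, hf1]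
  · rw [Set.IccExtend_of_right_le _ _ h2.ge, Set.domRestrict_apply, hf1,
      stepL_of_nonpos u (by linarith), add_zero]
  · rw [Set.IccExtend_of_mem _ _ (Set.mem_Icc.mpr ⟨h3.le, not_lt.mp h1⟩), Set.domRestrict_apply,
      stepL_of_nonpos u (by linarith), add_zero]
  · rw [Set.IccExtend_of_le_left _ _ (not_lt.mp h3), Set.domRestrict_apply, hf0,
      stepL_of_nonpos u (by linarith), add_zero]

theorem continuous_stepL (t : List ((V ≃ₗᵢ[ℝ] V) ⊕ (ℝ → V)))
    (ht : ∀ f : ℝ → V, Sum.inr f ∈ t → IsUnitCurve e f) : Continuous (stepL e t) := by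
  induction t with
  | nil => exact continuous_const
  | cons x u ih =>
    have hu := (ih fun f hf => ht f (List.mem_cons_of_mem _ hf)).comp
      (continuous_id.sub (continuous_const (y := (1 : ℝ))))
    rcases x with ρ | f
    · rw [funext (stepL_inl_cons ρ u)]
      exact ρ.continuous.comp hu
    · have hf := ht f List.mem_cons_self
      rw [funext (stepL_inr_cons hf u)]
      exact hf.1.domRestrict.Icc_extend'.add hu

theorem stepL_length (t : List ((V ≃ₗᵢ[ℝ] V) ⊕ (ℝ → V)))
    (ht : ∀ f : ℝ → V, Sum.inr f ∈ t → IsUnitCurve e f) :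
    stepL e t t.length = spanL e t := by
  induction t with
  | nil => rfl
  | cons x u ih =>
    have hu := ih fun f hf => ht f (List.mem_cons_of_mem _ hf)
    rcases x with ρ | f
    · rw [stepL_inl_cons, List.length_cons, Nat.cast_succ, add_sub_cancel_right, hu, spanL]
    · have hf := ht f List.mem_cons_self
      rw [stepL_inr_cons hf, List.length_cons, Nat.cast_succ, add_sub_cancel_right, hu, spanL,
        Set.IccExtend_of_right_le _ _ (le_add_of_nonneg_left u.length.cast_nonneg),
        Set.domRestrict_apply, hf.2.2]

end Step

/-- Interpretation of well-formed rules preserves unit curves: if the rule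
`(a, t)` is well-formed, `t` is nonempty, and every subcurve occurring in `t` is
a unit curve, then `draw (a, t)` is a unit curve. -/
theorem draw_wellFormed_isUnitCurve
    {V : Type*} [NormedAddCommGroup V] [NormedSpace ℝ V]
    (e : V) (he : e ≠ 0)
    (a : ℝ) (t : List ((V ≃ₗᵢ[ℝ] V) ⊕ (ℝ → V)))
    (hne : t ≠ [])
    (hwf : WellFormedRule e (a, t))
    (hcurves : ∀ f : ℝ → V, Sum.inr f ∈ t → IsUnitCurve e f) :
    IsUnitCurve e (draw e (a, t)) := by
  obtain ⟨ha, hspan, -⟩ := hwf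
  refine ⟨?_, ?_, ?_⟩
  · exact (((continuous_stepL t hcurves).comp (continuous_const.mul continuous_id)).const_smul
      a⁻¹).continuousOn
  · simp [draw, stepL_of_nonpos]
  · have ha0 : a ≠ 0 := (zero_lt_one.trans ha).ne'
    simp only [draw, mul_one, stepL_length t hcurves]
    rw [hspan, inv_smul_smul₀ ha0]
end
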